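/- arXiv:2011.08486 — 2 statements merged into one kernel-verified Lean document; each statement's English description precedes it below -/
import Mathlib

section
/- Let G be a finite abelian group, S ⊆ G a nonempty subset, Δ : G → Ĝ an isomorphism with adjoint Δ_* and σ = Δ⁻¹ ∘ Δ_*. Then the following are equivalent: (1) S is formally self dual under Δ; (2) there exist rational numbers λ_H, indexed by the subgroups H ≤ G, such that in the group algebra ℚG one has S·S^{(−1)} = ∑_{H ≤ G} λ_H·H, and for every subgroup H ≤ G both λ_{σ(H)} = λ_H and λ_{Δ⁻¹(H^⊥)} = (|H|/|S|)·λ_H hold. -/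
open scoped Classical

variable {G : Type*} [CommGroup G] [Fintype G]

/-- The weight enumerator `ν_S(g) = #{(s,t) ∈ S×S : s·t⁻¹ = g}`. -/
noncomputable def nu {A : Type*} [Group A] (S : Finset A) (g : A) : ℕ :=
  Nat.card {p : A × A // p.1 ∈ S ∧ p.2 ∈ S ∧ p.1 * p.2⁻¹ = g}

/-- `S` is formally self dual under the isomorphism `Δ : G → Ĝ`:
`|∑_{s∈S} [Δg](s)|² = |S|·ν_S(g)` for all `g ∈ G`. -/
def FormallySelfDual (Δ : G ≃* (G →* ℂˣ)) (S : Finset G) : Prop :=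
  ∀ g : G, ‖∑ s ∈ S, ((Δ g) s : ℂ)‖ ^ 2 = (S.card : ℝ) * nu S g

/-- The annihilator `H^⊥ = {χ ∈ Ĝ : χ(h) = 1 for all h ∈ H}`. -/
def Subgroup.perpDual (H : Subgroup G) : Subgroup (G →* ℂˣ) where
  carrier := {χ | ∀ h ∈ H, χ h = 1}
  one_mem' := fun h _ => rfl
  mul_mem' := fun {a b} ha hb h hh => by
    rw [MonoidHom.mul_apply, ha h hh, hb h hh, one_mul]
  inv_mem' := fun {a} ha h hh => by
    rw [MonoidHom.inv_apply, ha h hh, inv_one]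

/-- `S = ∑_{g ∈ S} g` as an element of the rational group algebra `ℚG`. -/
noncomputable def fsetElt (S : Finset G) : MonoidAlgebra ℚ G :=
  ∑ g ∈ S, MonoidAlgebra.of ℚ G g

/-- `S^{(-1)} = ∑_{g ∈ S} g⁻¹` as an element of `ℚG`. -/
noncomputable def fsetEltInv (S : Finset G) : MonoidAlgebra ℚ G :=
  ∑ g ∈ S, MonoidAlgebra.of ℚ G g⁻¹

/-- A subgroup `H ≤ G` as the element `∑_{g ∈ H} g` of `ℚG`. -/
noncomputable def sgElt (H : Subgroup G) : MonoidAlgebra ℚ G :=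
  ∑ g : G, if g ∈ H then MonoidAlgebra.of ℚ G g else 0

/-- A `ℚ`-linear relation between `n`-th roots of unity is preserved by `w ↦ w ^ k`
for `k` coprime to `n`. -/
theorem sum_mul_pow_eq_of_coprime {ι : Type*} (s : Finset ι) (c : ι → ℚ) (w : ι → ℂ) (r : ℚ)
    {n k : ℕ} (hn : 0 < n) (hk : k.Coprime n) (hw : ∀ i ∈ s, w i ^ n = 1)
    (h : ∑ i ∈ s, (c i : ℂ) * w i = r) : ∑ i ∈ s, (c i : ℂ) * w i ^ k = r := by
  have : NeZero n := ⟨hn.ne'⟩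
  have hζ := Complex.isPrimitiveRoot_exp n hn.ne'
  set ζ := Complex.exp (2 * Real.pi * Complex.I / n)
  have ha : ∀ i, ∃ a : ℕ, i ∈ s → ζ ^ a = w i := fun i => by
    by_cases hi : i ∈ s
    · obtain ⟨a, -, ha⟩ := hζ.eq_pow_of_pow_eq_one (hw i hi)
      exact ⟨a, fun _ => ha⟩
    · exact ⟨0, fun h => absurd h hi⟩
  choose a ha using ha
  let p : Polynomial ℚ := ∑ i ∈ s, Polynomial.C (c i) * Polynomial.X ^ a i - Polynomial.C r
  have hp : ∀ z : ℂ, Polynomial.aeval z p = ∑ i ∈ s, (c i : ℂ) * z ^ a i - r := fun z => by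
    simp [p]
  have h0 : Polynomial.aeval ζ p = 0 := by
    rw [hp, ← h, sub_eq_zero]
    exact Finset.sum_congr rfl fun i hi => by rw [ha i hi]
  have hmin : minpoly ℚ ζ = minpoly ℚ (ζ ^ k) := by
    rw [← Polynomial.cyclotomic_eq_minpoly_rat hζ hn,
      ← Polynomial.cyclotomic_eq_minpoly_rat (hζ.pow_of_coprime k hk) hn]
  have h1 : Polynomial.aeval (ζ ^ k) p = 0 :=
    (minpoly.dvd_iff).mp (hmin ▸ minpoly.dvd ℚ ζ h0)
  rw [hp, sub_eq_zero] at h1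
  rw [← h1]
  refine Finset.sum_congr rfl fun i hi => ?_
  rw [← ha i hi, ← pow_mul, ← pow_mul, mul_comm k]

/-- Every function on a finite partial order is a sum over upper sets. -/
theorem exists_sum_ite_le_eq {P : Type*} [PartialOrder P] [Fintype P] (f : P → ℚ) :
    ∃ lam : P → ℚ, ∀ K, ∑ H, (if K ≤ H then lam H else 0) = f K := by
  let lam : P → ℚ := (wellFounded_gt (α := P)).fix
    (fun K rec => f K - ∑ H : P, if h : K < H then rec H h else 0)
  have hlam : ∀ K, lam K = f K - ∑ H : P, if K < H then lam H else 0 := fun K => by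
    refine ((wellFounded_gt (α := P)).fix_eq _ K).trans ?_
    simp only [dite_eq_ite]
    rfl
  refine ⟨lam, fun K => ?_⟩
  have : ∀ H, (if K ≤ H then lam H else 0)
      = (if K = H then lam H else 0) + (if K < H then lam H else 0) := fun H => by
    rcases eq_or_ne K H with rfl | hne
    · simp
    · simp [hne, lt_iff_le_and_ne]
  simp only [this, Finset.sum_add_distrib, Finset.sum_ite_eq, Finset.mem_univ, if_true]
  rw [hlam K, sub_add_cancel]

/-- A finite orbit of a linear map on which `φ` is constant can be averaged to a fixed point
with the same value under `φ`. -/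
theorem exists_fixed_of_pow_apply_eq {V W : Type*} [AddCommGroup V] [Module ℚ V] [AddCommGroup W]
    [Module ℚ W] (T : Module.End ℚ V) (φ : V →ₗ[ℚ] W) (v : V) {N : ℕ} (hN : 0 < N)
    (hT : (T ^ N) v = v) (hφ : ∀ u, φ u = φ v → φ (T u) = φ v) : ∃ u, T u = u ∧ φ u = φ v := by
  have hφi : ∀ i : ℕ, φ ((T ^ i) v) = φ v := fun i => by
    induction i with
    | zero => simp
    | succ i ih => rw [pow_succ']; exact hφ _ ih
  refine ⟨(N : ℚ)⁻¹ • ∑ i ∈ Finset.range N, (T ^ i) v, ?_, ?_⟩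
  · rw [map_smul, map_sum]
    congr 1
    have : ∀ i, T ((T ^ i) v) = (T ^ (i + 1)) v := fun i => by rw [pow_succ']; rfl
    simp only [this]
    have h := (Finset.sum_range_succ (fun i => (T ^ i) v) N).symm.trans
      (Finset.sum_range_succ' (fun i => (T ^ i) v) N)
    rw [hT, pow_zero, Module.End.one_apply] at h
    exact (add_right_cancel h).symm
  · rw [map_smul, map_sum]
    simp only [hφi, Finset.sum_const, Finset.card_range]
    rw [← Nat.cast_smul_eq_nsmul ℚ, smul_smul, inv_mul_cancel₀ (by positivity), one_smul]

theorem sum_nu_mul {R : Type*} [CommSemiring R] (S : Finset G) (F : G → R) :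
    ∑ g, (nu S g : R) * F g = ∑ s ∈ S, ∑ t ∈ S, F (s * t⁻¹) := by
  have hnu : ∀ g, nu S g = ((S ×ˢ S).filter fun p => p.1 * p.2⁻¹ = g).card := fun g => by
    rw [nu, Nat.card_eq_fintype_card, Fintype.card_subtype]
    congr 1
    ext p
    simp [and_assoc]
  rw [← Finset.sum_product' S S fun s t => F (s * t⁻¹),
    ← Finset.sum_fiberwise (S ×ˢ S) (fun p => p.1 * p.2⁻¹)]
  refine Finset.sum_congr rfl fun g _ => ?_
  rw [hnu, ← nsmul_eq_mul, ← Finset.sum_const]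
  exact Finset.sum_congr rfl fun p hp => by rw [(Finset.mem_filter.mp hp).2]

theorem fsetElt_mul_fsetEltInv_coeff (S : Finset G) (g : G) :
    (fsetElt S * fsetEltInv S).coeff g = (nu S g : ℚ) := by
  have h := sum_nu_mul S (fun x => if x = g then (1 : ℚ) else 0)
  simp only [mul_ite, mul_one, mul_zero, Finset.sum_ite_eq', Finset.mem_univ, if_true] at h
  rw [h, fsetElt, fsetEltInv, Finset.sum_mul_sum]
  simp [MonoidAlgebra.coeff_sum, Finsupp.single_apply]

theorem sum_smul_sgElt_coeff (lam : Subgroup G → ℚ) (g : G) :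
    (∑ᶠ H : Subgroup G, lam H • sgElt H).coeff g = ∑ H, if g ∈ H then lam H else 0 := by
  rw [finsum_eq_sum_of_fintype, MonoidAlgebra.coeff_sum, Finsupp.finsetSum_apply]
  refine Finset.sum_congr rfl fun H _ => ?_
  have : (sgElt H).coeff g = if g ∈ H then 1 else 0 := by
    rw [sgElt, MonoidAlgebra.coeff_sum, Finsupp.finsetSum_apply, Finset.sum_eq_single g]
    · split_ifs <;> simp
    · intro b _ hb
      split_ifs <;> simp [hb]
    · simp
  simp [this]

theorem fsetElt_mul_fsetEltInv_eq_iff (S : Finset G) (lam : Subgroup G → ℚ) :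
    fsetElt S * fsetEltInv S = ∑ᶠ H : Subgroup G, lam H • sgElt H ↔
      ∀ g, ∑ H, (if g ∈ H then lam H else 0) = (nu S g : ℚ) := by
  rw [← MonoidAlgebra.coeff_inj, Finsupp.ext_iff]
  simp only [fsetElt_mul_fsetEltInv_coeff, sum_smul_sgElt_coeff, eq_comm]

theorem norm_sq_sum_eq_sum_nu (S : Finset G) (χ : G →* ℂˣ) :
    ((‖∑ s ∈ S, (χ s : ℂ)‖ ^ 2 : ℝ) : ℂ) = ∑ g, (nu S g : ℂ) * χ g := by
  have hconj : ∀ t, (starRingEnd ℂ) (χ t : ℂ) = (χ t⁻¹ : ℂ) := fun t => by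
    have hpow : (χ t : ℂ) ^ Fintype.card G = 1 := by
      rw [← Units.val_pow_eq_pow_val, ← map_pow, pow_card_eq_one, map_one, Units.val_one]
    rw [map_inv, Units.val_inv_eq_inv_val,
      Complex.inv_eq_conj (Complex.norm_eq_one_of_pow_eq_one hpow Fintype.card_ne_zero)]
  rw [sum_nu_mul, Complex.ofReal_pow, ← Complex.mul_conj', map_sum, Finset.sum_mul_sum]
  simp only [hconj, map_mul, Units.val_mul]

theorem formallySelfDual_iff (Δ : G ≃* (G →* ℂˣ)) (S : Finset G) :
    FormallySelfDual Δ S ↔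
      ∀ x, ∑ g, (nu S g : ℂ) * (Δ x g : ℂ) = (S.card : ℂ) * nu S x := by
  refine forall_congr' fun x => ?_
  rw [← norm_sq_sum_eq_sum_nu]
  norm_cast

theorem sum_units_val_eq_ite {A : Type*} [Group A] [Fintype A] (χ : A →* ℂˣ) :
    ∑ a, (χ a : ℂ) = if χ = 1 then (Fintype.card A : ℂ) else 0 := by
  have h := sum_hom_units ((Units.coeHom ℂ).comp χ)
  have hiff : (Units.coeHom ℂ).comp χ = 1 ↔ χ = 1 := by
    simp [MonoidHom.ext_iff]
  simpa [hiff] using h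

/-- The map `H ↦ Δ⁻¹(H^⊥)` on subgroups. -/
noncomputable abbrev Subgroup.dualMap (Δ : G ≃* (G →* ℂˣ)) (H : Subgroup G) : Subgroup G :=
  H.perpDual.map Δ.symm.toMonoidHom

theorem Subgroup.mem_dualMap {A : Type*} [CommGroup A] (Δ : A ≃* (A →* ℂˣ)) (H : Subgroup A)
    (x : A) :
    x ∈ H.dualMap Δ ↔ ∀ h ∈ H, Δ x h = 1 := by
  constructor
  · rintro ⟨χ, hχ, rfl⟩ h hh
    simpa using hχ h hh
  · exact fun h => ⟨Δ x, h, Δ.symm_apply_apply x⟩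

theorem sum_subgroup_eq_ite (Δ : G ≃* (G →* ℂˣ)) (H : Subgroup G) (x : G) :
    ∑ g, (if g ∈ H then (Δ x g : ℂ) else 0) = if x ∈ H.dualMap Δ then (Nat.card H : ℂ) else 0 := by
  have h := sum_units_val_eq_ite ((Δ x).comp H.subtype)
  have hiff : (Δ x).comp H.subtype = 1 ↔ x ∈ H.dualMap Δ := by
    rw [Subgroup.mem_dualMap]
    simp [MonoidHom.ext_iff]
  rw [← Finset.sum_filter, Nat.card_eq_fintype_card]
  simp only [hiff] at h
  rw [← h]
  exact Finset.sum_subtype _ (by simp) fun g => (Δ x g : ℂ)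

theorem sum_sum_ite_mul (Δ : G ≃* (G →* ℂˣ)) (lam : Subgroup G → ℚ) (x : G) :
    ∑ g, ((∑ H : Subgroup G, if g ∈ H then lam H else 0 : ℚ) : ℂ) * (Δ x g : ℂ) =
      ((∑ H : Subgroup G, if x ∈ H.dualMap Δ then Nat.card H * lam H else 0 : ℚ) : ℂ) := by
  push_cast
  simp only [Finset.sum_mul]
  rw [Finset.sum_comm]
  refine Finset.sum_congr rfl fun H _ => ?_
  have h := congrArg ((lam H : ℂ) * ·) (sum_subgroup_eq_ite Δ H x)
  simp only [Finset.mul_sum] at h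
  convert h using 1
  · refine Finset.sum_congr rfl fun g _ => ?_
    split_ifs <;> simp
  · split_ifs <;> simp [mul_comm]

theorem sum_apply_eq_ite {Δ Δstar : G ≃* (G →* ℂˣ)} (hadj : ∀ x y : G, (Δstar y) x = (Δ x) y)
    (g : G) : ∑ x, (Δ x g : ℂ) = if g = 1 then (Fintype.card G : ℂ) else 0 := by
  simp only [← hadj, sum_units_val_eq_ite, EmbeddingLike.map_eq_one_iff]

theorem Subgroup.card_mul_card_dualMap {Δ Δstar : G ≃* (G →* ℂˣ)}
    (hadj : ∀ x y : G, (Δstar y) x = (Δ x) y) (H : Subgroup G) :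
    Nat.card H * Nat.card (H.dualMap Δ) = Nat.card G := by
  have h : ∑ x, ∑ g, (if g ∈ H then (Δ x g : ℂ) else 0) =
      ∑ x, if x ∈ H.dualMap Δ then (Nat.card H : ℂ) else 0 :=
    Finset.sum_congr rfl fun x _ => sum_subgroup_eq_ite Δ H x
  rw [Finset.sum_comm] at h
  have h2 : ∀ g, ∑ x, (if g ∈ H then (Δ x g : ℂ) else 0) =
      if g = 1 then (Fintype.card G : ℂ) else 0 := fun g => by
    by_cases hg : g ∈ H
    · simp only [hg, if_true, sum_apply_eq_ite hadj]
    · have : g ≠ 1 := fun h => hg (h ▸ H.one_mem)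
      simp [hg, this]
  simp only [h2, Finset.sum_ite_eq', Finset.mem_univ, if_true] at h
  rw [← Finset.sum_filter, Finset.sum_const, nsmul_eq_mul, ← Fintype.card_subtype,
    ← Nat.card_eq_fintype_card, ← Nat.card_eq_fintype_card] at h
  rw [mul_comm]
  exact_mod_cast h.symm

theorem Subgroup.dualMap_dualMap {Δ Δstar : G ≃* (G →* ℂˣ)}
    (hadj : ∀ x y : G, (Δstar y) x = (Δ x) y) (H : Subgroup G) :
    (H.dualMap Δ).dualMap Δ = H.map (Δstar.trans Δ.symm).toMonoidHom := by
  symm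
  apply Subgroup.eq_of_le_of_card_ge
  · rintro _ ⟨h, hh, rfl⟩
    rw [Subgroup.mem_dualMap]
    intro y hy
    rw [Subgroup.mem_dualMap] at hy
    simpa [hadj] using hy h hh
  · have h1 := H.card_mul_card_dualMap hadj
    have h2 := (H.dualMap Δ).card_mul_card_dualMap hadj
    have h3 : Nat.card (H.map (Δstar.trans Δ.symm).toMonoidHom) = Nat.card H :=
      Subgroup.card_map_of_injective (Δstar.trans Δ.symm).injective
    rw [h3]
    refine (Nat.eq_of_mul_eq_mul_left (Nat.card_pos (α := H.dualMap Δ)) ?_).le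
    rw [h2, ← h1, mul_comm]

theorem Subgroup.dualMap_bijective {Δ Δstar : G ≃* (G →* ℂˣ)}
    (hadj : ∀ x y : G, (Δstar y) x = (Δ x) y) :
    Function.Bijective (Subgroup.dualMap Δ) := by
  refine Finite.injective_iff_bijective.mp fun H K h => ?_
  have h' := congrArg (Subgroup.dualMap Δ) h
  rw [Subgroup.dualMap_dualMap hadj, Subgroup.dualMap_dualMap hadj] at h'
  exact Subgroup.map_injective (Δstar.trans Δ.symm).injective h'

theorem nu_pow_eq {Δ : G ≃* (G →* ℂˣ)} {S : Finset G} (hS : S.Nonempty)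
    (hd : FormallySelfDual Δ S) (x : G) {k : ℕ} (hk : k.Coprime (orderOf x)) :
    nu S (x ^ k) = nu S x := by
  rw [formallySelfDual_iff] at hd
  have h := sum_mul_pow_eq_of_coprime Finset.univ (fun g => (nu S g : ℚ))
    (fun g => (Δ x g : ℂ)) (S.card * nu S x) (orderOf_pos x) hk
    (fun g _ => by
      rw [← Units.val_pow_eq_pow_val, ← MonoidHom.pow_apply, ← map_pow, pow_orderOf_eq_one]
      simp)
    (by push_cast; exact hd x)
  have h2 := hd (x ^ k)
  simp only [map_pow, MonoidHom.pow_apply, Units.val_pow_eq_pow_val] at h2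
  push_cast at h
  rw [h2] at h
  have hc : (S.card : ℂ) ≠ 0 := by exact_mod_cast hS.card_pos.ne'
  exact_mod_cast mul_left_cancel₀ hc h

theorem nu_eq_of_zpowers_eq {Δ : G ≃* (G →* ℂˣ)} {S : Finset G} (hS : S.Nonempty)
    (hd : FormallySelfDual Δ S) {x y : G} (h : Subgroup.zpowers x = Subgroup.zpowers y) :
    nu S x = nu S y := by
  have hy : y ∈ Submonoid.powers x := by
    rw [mem_powers_iff_mem_zpowers, h]
    exact Subgroup.mem_zpowers y
  obtain ⟨k, rfl⟩ := hy
  have hx : x ∈ Subgroup.zpowers (x ^ k) := h ▸ Subgroup.mem_zpowers x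
  rw [mem_zpowers_pow_iff] at hx
  exact (nu_pow_eq hS hd x hx).symm

theorem exists_sum_ite_mem_eq_nu {Δ : G ≃* (G →* ℂˣ)} {S : Finset G} (hS : S.Nonempty)
    (hd : FormallySelfDual Δ S) :
    ∃ lam : Subgroup G → ℚ, ∀ g, ∑ H, (if g ∈ H then lam H else 0) = (nu S g : ℚ) := by
  obtain ⟨lam, hlam⟩ := exists_sum_ite_le_eq (P := Subgroup G)
    (fun K => if h : ∃ g, Subgroup.zpowers g = K then (nu S h.choose : ℚ) else 0)
  refine ⟨lam, fun g => ?_⟩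
  have h := hlam (Subgroup.zpowers g)
  have hg : ∃ g', Subgroup.zpowers g' = Subgroup.zpowers g := ⟨g, rfl⟩
  simp only [Subgroup.zpowers_le, dif_pos hg] at h
  rw [h, nu_eq_of_zpowers_eq hS hd hg.choose_spec]

theorem card_eq_card_sq {Δ Δstar : G ≃* (G →* ℂˣ)}
    (hadj : ∀ x y : G, (Δstar y) x = (Δ x) y) {S : Finset G} (hS : S.Nonempty)
    (hd : FormallySelfDual Δ S) : Nat.card G = S.card ^ 2 := by
  rw [formallySelfDual_iff] at hd
  have h := Finset.sum_congr rfl fun x (_ : x ∈ Finset.univ) => hd x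
  rw [Finset.sum_comm] at h
  have hone : (nu S 1 : ℂ) = S.card := by
    have h1 := sum_nu_mul S (fun x => if x = 1 then (1 : ℂ) else 0)
    simpa [mul_inv_eq_one] using h1
  have htot := sum_nu_mul S (fun _ => (1 : ℂ))
  simp only [← Finset.mul_sum, sum_apply_eq_ite hadj, mul_ite, mul_zero, Finset.sum_ite_eq',
    Finset.mem_univ, if_true, hone] at h
  simp only [mul_one, Finset.sum_const, nsmul_eq_mul] at htot
  rw [htot] at h
  have hc : (S.card : ℂ) ≠ 0 := by exact_mod_cast hS.card_pos.ne'
  rw [Nat.card_eq_fintype_card]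
  have := mul_left_cancel₀ hc h
  rw [pow_two]
  exact_mod_cast this

theorem formallySelfDual_of_sum_eq {Δ Δstar : G ≃* (G →* ℂˣ)}
    (hadj : ∀ x y : G, (Δstar y) x = (Δ x) y) {S : Finset G} (hS : S.Nonempty)
    {lam : Subgroup G → ℚ} (hlam : ∀ g, ∑ H, (if g ∈ H then lam H else 0) = (nu S g : ℚ))
    (hdual : ∀ H : Subgroup G, lam (H.dualMap Δ) = ((Nat.card H : ℚ) / (S.card : ℚ)) * lam H) :
    FormallySelfDual Δ S := by
  have hc : (S.card : ℚ) ≠ 0 := by exact_mod_cast hS.card_pos.ne'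
  rw [formallySelfDual_iff]
  intro x
  have h := sum_sum_ite_mul Δ lam x
  have hx : (∑ H : Subgroup G, if x ∈ H.dualMap Δ then Nat.card H * lam H else 0 : ℚ) =
      S.card * nu S x := by
    rw [← hlam x, ← (Subgroup.dualMap_bijective hadj).sum_comp fun K => if x ∈ K then lam K else 0,
      Finset.mul_sum]
    refine Finset.sum_congr rfl fun H _ => ?_
    rw [hdual]
    split_ifs
    · field_simp
    · simp
  simp only [hlam] at h
  rw [hx] at h
  exact_mod_cast h

/-- The linear map sending a coefficient family `lam` to `g ↦ ∑_{H ∋ g} lam H`. -/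
noncomputable def subgroupSum : (Subgroup G → ℚ) →ₗ[ℚ] (G → ℚ) where
  toFun lam g := ∑ H, if g ∈ H then lam H else 0
  map_add' a b := by
    ext g
    simp [← Finset.sum_add_distrib, ite_add_zero]
  map_smul' c a := by
    ext g
    simp [Finset.mul_sum]

/-- The linear map `T` on coefficient families with `T lam (τ H) = (|H| / c) * lam H`. -/
noncomputable def weightedTransport (τ : Equiv.Perm (Subgroup G)) (c : ℚ) :
    Module.End ℚ (Subgroup G → ℚ) where
  toFun lam K := ((Nat.card (τ.symm K) : ℚ) / c) * lam (τ.symm K)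
  map_add' a b := by
    ext K
    simp [mul_add]
  map_smul' r a := by
    ext K
    simp [mul_left_comm]

theorem weightedTransport_apply (τ : Equiv.Perm (Subgroup G)) (c : ℚ) (lam : Subgroup G → ℚ)
    (H : Subgroup G) : weightedTransport τ c lam (τ H) = ((Nat.card H : ℚ) / c) * lam H := by
  simp [weightedTransport]

theorem weightedTransport_pow_eq (τ : Equiv.Perm (Subgroup G)) {c : ℚ} (hc : c ≠ 0)
    (hτ : ∀ H : Subgroup G, (Nat.card H : ℚ) * Nat.card (τ H) = c ^ 2) (lam : Subgroup G → ℚ) :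
    ((weightedTransport τ c) ^ (2 * orderOf τ)) lam = lam := by
  have hsq : ∀ (mu : Subgroup G → ℚ) (H : Subgroup G),
      ((weightedTransport τ c) ^ 2) mu ((τ ^ 2) H) = mu H := fun mu H => by
    rw [pow_two, pow_two, Module.End.mul_apply, Equiv.Perm.mul_apply, weightedTransport_apply,
      weightedTransport_apply]
    have := hτ H
    field_simp
    linear_combination mu H * this
  have hiter : ∀ (k : ℕ) (H : Subgroup G),
      (((weightedTransport τ c) ^ 2) ^ k) lam (((τ ^ 2) ^ k) H) = lam H := fun k => by
    induction k with
    | zero => simp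
    | succ k ih =>
      intro H
      rw [pow_succ' _ k, pow_succ' _ k, Module.End.mul_apply, Equiv.Perm.mul_apply, hsq, ih]
  ext H
  have h := hiter (orderOf τ) H
  rwa [← pow_mul, ← pow_mul, mul_comm 2 (orderOf τ), pow_mul τ, pow_orderOf_eq_one, one_pow,
    Equiv.Perm.one_apply, mul_comm (orderOf τ)] at h

theorem subgroupSum_weightedTransport {Δ : G ≃* (G →* ℂˣ)} {S : Finset G} (hS : S.Nonempty)
    (hd : FormallySelfDual Δ S) (τ : Equiv.Perm (Subgroup G)) (hτ : ∀ H, τ H = H.dualMap Δ)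
    {lam : Subgroup G → ℚ} (hlam : ∀ g, subgroupSum lam g = (nu S g : ℚ)) (x : G) :
    subgroupSum (weightedTransport τ S.card lam) x = (nu S x : ℚ) := by
  have hc : (S.card : ℚ) ≠ 0 := by exact_mod_cast hS.card_pos.ne'
  have h := sum_sum_ite_mul Δ lam x
  have hlam' : ∀ g, ∑ H, (if g ∈ H then lam H else 0) = (nu S g : ℚ) := hlam
  simp only [hlam'] at h
  have hx := (formallySelfDual_iff Δ S).mp hd x
  push_cast at h
  rw [hx] at h
  have h' : (S.card : ℚ) * nu S x =
      ∑ H : Subgroup G, if x ∈ H.dualMap Δ then Nat.card H * lam H else 0 := by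
    exact_mod_cast h
  apply mul_left_cancel₀ hc
  rw [h']
  change _ * ∑ K, (if x ∈ K then weightedTransport τ S.card lam K else 0) = _
  rw [← Equiv.sum_comp τ, Finset.mul_sum]
  refine Finset.sum_congr rfl fun H _ => ?_
  rw [weightedTransport_apply, hτ]
  split_ifs
  · field_simp
  · simp

theorem exists_sum_eq_of_formallySelfDual {Δ Δstar : G ≃* (G →* ℂˣ)}
    (hadj : ∀ x y : G, (Δstar y) x = (Δ x) y) {S : Finset G} (hS : S.Nonempty)
    (hd : FormallySelfDual Δ S) :
    ∃ lam : Subgroup G → ℚ, (∀ g, ∑ H, (if g ∈ H then lam H else 0) = (nu S g : ℚ)) ∧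
      ∀ H : Subgroup G, lam (H.dualMap Δ) = ((Nat.card H : ℚ) / (S.card : ℚ)) * lam H := by
  have hc : (S.card : ℚ) ≠ 0 := by exact_mod_cast hS.card_pos.ne'
  obtain ⟨mu, hmu⟩ := exists_sum_ite_mem_eq_nu hS hd
  let τ : Equiv.Perm (Subgroup G) := Equiv.ofBijective _ (Subgroup.dualMap_bijective hadj)
  have hτ : ∀ H, τ H = H.dualMap Δ := fun _ => rfl
  have hφ : subgroupSum mu = fun g => (nu S g : ℚ) := funext hmu
  obtain ⟨lam, hfix, hlam⟩ := exists_fixed_of_pow_apply_eq (weightedTransport τ S.card)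
    subgroupSum mu (N := 2 * orderOf τ) (by have := orderOf_pos τ; positivity)
    (weightedTransport_pow_eq τ hc (fun H => by
      rw [hτ]
      exact_mod_cast (H.card_mul_card_dualMap hadj).trans (card_eq_card_sq hadj hS hd)) mu)
    (fun u hu => by
      rw [hφ] at hu ⊢
      exact funext (subgroupSum_weightedTransport hS hd τ hτ (congrFun hu)))
  refine ⟨lam, fun g => congrFun (hlam.trans hφ) g, fun H => ?_⟩
  have h := weightedTransport_apply τ S.card lam H
  rwa [hfix] at h

theorem stmt4 (S : Finset G) (hS : S.Nonempty) (Δ Δstar : G ≃* (G →* ℂˣ))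
    (hadj : ∀ x y : G, (Δstar y) x = (Δ x) y) :
    FormallySelfDual Δ S ↔
      ∃ lam : Subgroup G → ℚ,
        fsetElt S * fsetEltInv S = (∑ᶠ H : Subgroup G, lam H • sgElt H) ∧
        ∀ H : Subgroup G,
          lam (H.map (Δstar.trans Δ.symm).toMonoidHom) = lam H ∧
          lam (H.perpDual.map Δ.symm.toMonoidHom) = ((Nat.card H : ℚ) / (S.card : ℚ)) * lam H := by
  simp only [fsetElt_mul_fsetEltInv_eq_iff]
  constructor
  · intro hd
    obtain ⟨lam, hlam, hdual⟩ := exists_sum_eq_of_formallySelfDual hadj hS hd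
    refine ⟨lam, hlam, fun H => ⟨?_, hdual H⟩⟩
    have hc : (S.card : ℚ) ≠ 0 := by exact_mod_cast hS.card_pos.ne'
    have hcard : (Nat.card H : ℚ) * Nat.card (H.dualMap Δ) = (S.card : ℚ) ^ 2 := by
      exact_mod_cast (H.card_mul_card_dualMap hadj).trans (card_eq_card_sq hadj hS hd)
    rw [← Subgroup.dualMap_dualMap hadj, hdual, hdual]
    field_simp
    linear_combination lam H * hcard
  · rintro ⟨lam, hlam, h⟩
    exact formallySelfDual_of_sum_eq hadj hS hlam fun H => (h H).2
end

section
/- Let G be a finite abelian group, Δ : G → Ĝ an isomorphism, and φ an automorphism of G admitting an adjoint automorphism φ* (i.e., [Δ(φ(x))](y) = [Δx](φ*(y)) for all x, y ∈ G) with φ ∘ φ* = id_G. If S ⊆ G is formally self dual under Δ, then φ(S) is also formally self dual under Δ. -/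
variable {G : Type*} [CommGroup G] [Fintype G]

/-- The weight enumerator of the image of `S` under an isomorphism. -/
theorem nu_map {A B : Type*} [Group A] [Group B] (S : Finset A) (e : A ≃* B) (a : A) :
    nu (S.map e.toEquiv.toEmbedding) (e a) = nu S a := by
  refine (Nat.card_congr ((e.toEquiv.prodCongr e.toEquiv).subtypeEquiv fun p => ?_)).symm
  simp [← map_inv, ← map_mul]

theorem stmt15 (S : Finset G) (Δ : G ≃* (G →* ℂˣ)) (φ φstar : G ≃* G)
    (hadj : ∀ x y : G, (Δ (φ x)) y = (Δ x) (φstar y))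
    (hinv : ∀ x : G, φ (φstar x) = x)
    (h : FormallySelfDual Δ S) :
    FormallySelfDual Δ (S.map φ.toEquiv.toEmbedding) := by
  have hinv' (x : G) : φstar (φ x) = x := φ.injective (hinv _)
  intro g
  obtain ⟨x, rfl⟩ := φ.surjective g
  have hsum : ∑ s ∈ S.map φ.toEquiv.toEmbedding, ((Δ (φ x)) s : ℂ) = ∑ s ∈ S, ((Δ x) s : ℂ) := by
    simp [hadj, hinv']
  rw [hsum, nu_map, Finset.card_map]
  exact h x
end
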